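/- For n ≥ 0 and 0 ≤ m ≤ n+1 the squared L² norm of X_{n,m}^{±} over the unit ball equals 2π(n+1)(δ_{0,m}+1)(n+m+1)! / ((2n+3)(n-m+1)!), and for n ≤ -2 and 0 ≤ m ≤ -n-2 the squared L² norm over the exterior of the unit ball equals 2π(n+1)(δ_{0,m}+1)(-n-2+m)! / ((2n+3)(-n-2-m)!). -/

import Mathlib

open MeasureTheory Real

noncomputable section

/-- Euclidean space `ℝ³` with coordinates `x 0, x 1, x 2`. -/
abbrev E3 := EuclideanSpace ℝ (Fin 3)

/-- Legendre polynomial of degree `n` via Rodrigues' formula. -/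
def legendreP (n : ℕ) (t : ℝ) : ℝ :=
  (1 / (2 ^ n * n.factorial : ℝ)) * iteratedDeriv n (fun s : ℝ => (s ^ 2 - 1) ^ n) t

/-- Associated Legendre function of nonnegative integer degree `n` and order `m`
(Ferrers-type definition, no Condon–Shortley phase):
`P_n^m(t) = (1-t²)^{m/2} (d/dt)^m P_n(t)`. -/
def assocLegendreNat (n m : ℕ) (t : ℝ) : ℝ :=
  (1 - t ^ 2) ^ ((m : ℝ) / 2) * iteratedDeriv m (legendreP n) t

/-- Associated Legendre function of arbitrary integer degree, using the
reflection `P_{-n}^m = P_{n-1}^m` for negative degrees. -/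
def assocLegendre (n : ℤ) (m : ℕ) (t : ℝ) : ℝ :=
  if 0 ≤ n then assocLegendreNat n.toNat m t else assocLegendreNat (-n - 1).toNat m t

/-- Spherical radius `ρ`. -/
def sphRho (x : E3) : ℝ := Real.sqrt (x 0 ^ 2 + x 1 ^ 2 + x 2 ^ 2)

/-- Azimuthal angle `φ` of the point `(x₁, x₂)`. -/
def sphPhi (x : E3) : ℝ := Complex.arg ⟨x 1, x 2⟩

/-- Azimuthal factor `Φ_m^±(φ)`; `sgn = true` corresponds to `+` (cosine),
`sgn = false` to `−` (sine). -/
def PhiFac (m : ℕ) (sgn : Bool) (φ : ℝ) : ℝ :=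
  if sgn then Real.cos (m * φ) else Real.sin (m * φ)

/-- Solid spherical harmonic `U_{n,m}^{±}(x) = ρ^n P_n^m(cos θ) Φ_m^{±}(φ)`. -/
def solidU (n : ℤ) (m : ℕ) (sgn : Bool) (x : E3) : ℝ :=
  sphRho x ^ n * assocLegendre n m (x 0 / sphRho x) * PhiFac m sgn (sphPhi x)

/-- The exterior `B^e` of the closed unit ball in `ℝ³`. -/
def extB : Set E3 := {x : E3 | 1 < ‖x‖}

/-- The quaternions; the subspace `𝒜 = ℝ + ℝe₁ + ℝe₂` consists of those
quaternions with `imK = 0`. -/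
abbrev H := Quaternion ℝ

def qe1 : H := ⟨0, 1, 0, 0⟩
def qe2 : H := ⟨0, 0, 1, 0⟩

/-- Partial derivative `∂/∂xᵢ` of a quaternion-valued function. -/
def pd (i : Fin 3) (f : E3 → H) (x : E3) : H :=
  fderiv ℝ f x (EuclideanSpace.single i 1)

/-- The Cauchy–Riemann (Fueter) operator `∂̄ = ∂/∂x₀ + e₁∂/∂x₁ + e₂∂/∂x₂`. -/
def Dbar (f : E3 → H) (x : E3) : H := pd 0 f x + qe1 * pd 1 f x + qe2 * pd 2 f x

/-- The conjugate Fueter operator `∂ = ∂/∂x₀ − e₁∂/∂x₁ − e₂∂/∂x₂`. -/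
def Dop (f : E3 → H) (x : E3) : H := pd 0 f x - qe1 * pd 1 f x - qe2 * pd 2 f x

/-- The solid harmonic `U_{n,m}^±` regarded as a quaternion-valued function. -/
def solidUq (n : ℤ) (m : ℕ) (sgn : Bool) (x : E3) : H := ((solidU n m sgn x : ℝ) : H)

/-- The basic spherical monogenic `X_{n,m}^{±} = ∂U_{n+1,m}^{±}`. -/
def Xmon (n : ℤ) (m : ℕ) (sgn : Bool) : E3 → H := Dop (solidUq (n + 1) m sgn)

/-- The scalar inner product on `𝒜`-valued quaternions:
`⟨p,q⟩ = p₀q₀ + p₁q₁ + p₂q₂`. -/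
def qip (p q : H) : ℝ := p.re * q.re + p.imI * q.imI + p.imJ * q.imJ

set_option linter.all false
open Polynomial in
/-- The polynomial `(d/dX)^m P_k`. -/
def Qp (k m : ℕ) : ℝ[X] :=
  C (1 / (2 ^ k * k.factorial : ℝ)) * derivative^[k + m] ((X ^ 2 - 1) ^ k)

lemma iteratedDeriv_poly (p : Polynomial ℝ) (j : ℕ) :
    iteratedDeriv j (fun t => p.eval t) = fun t => (Polynomial.derivative^[j] p).eval t := by
  induction j with
  | zero => simp
  | succ j ih =>
    rw [iteratedDeriv_succ, ih, Function.iterate_succ_apply']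
    ext t
    simp

lemma legendreP_eq (k : ℕ) : legendreP k = fun t => (Qp k 0).eval t := by
  ext t
  have h := iteratedDeriv_poly ((Polynomial.X ^ 2 - 1) ^ k) k
  have h2 : (fun t : ℝ => ((Polynomial.X ^ 2 - 1 : Polynomial ℝ) ^ k).eval t)
      = fun s : ℝ => (s ^ 2 - 1) ^ k := by ext s; simp
  rw [h2] at h
  rw [legendreP, h, Qp]
  simp

lemma Qp_deriv (k m : ℕ) : Polynomial.derivative (Qp k m) = Qp k (m + 1) := by
  rw [Qp, Qp, Polynomial.derivative_C_mul, ← Function.iterate_succ_apply' (f := Polynomial.derivative)]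
  rfl

lemma Qp_iter (k m : ℕ) : Polynomial.derivative^[m] (Qp k 0) = Qp k m := by
  induction m with
  | zero => rfl
  | succ m ih => rw [Function.iterate_succ_apply', ih, Qp_deriv]

lemma iter_leg (k m : ℕ) : iteratedDeriv m (legendreP k) = fun t => (Qp k m).eval t := by
  rw [legendreP_eq, iteratedDeriv_poly, Qp_iter]

open Polynomial in
lemma R_ode (k j : ℕ) :
    (X ^ 2 - 1) * derivative^[j + 2] ((X ^ 2 - 1 : ℝ[X]) ^ k)
      + C (2 * ((j : ℝ) + 1 - k)) * X * derivative^[j + 1] ((X ^ 2 - 1 : ℝ[X]) ^ k)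
      + C (((j : ℝ) + 1) * (j - 2 * k)) * derivative^[j] ((X ^ 2 - 1 : ℝ[X]) ^ k) = 0 := by
  induction j with
  | zero =>
    have h1 : (X ^ 2 - 1) * derivative ((X ^ 2 - 1 : ℝ[X]) ^ k)
        = C (2 * (k : ℝ)) * X * (X ^ 2 - 1 : ℝ[X]) ^ k := by
      cases k with
      | zero => simp
      | succ k =>
        rw [derivative_pow]
        simp only [derivative_sub, derivative_pow, derivative_X, derivative_one, C_mul, C_add, C_eq_natCast, map_natCast, Nat.add_sub_cancel]
        push_cast
        simp only [map_one, map_ofNat, C_add, map_natCast]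
        ring
    have h2 := congrArg derivative h1
    simp only [derivative_mul, derivative_sub, derivative_X_pow, derivative_one, derivative_X, derivative_C] at h2
    simp only [Function.iterate_succ_apply', Function.iterate_zero_apply, Nat.cast_zero]
    simp only [map_mul, map_sub, map_add, map_one, map_ofNat, map_natCast, map_zero] at h2 ⊢
    simp only [Nat.cast_ofNat] at h2
    linear_combination h2
  | succ j ih =>
    have h2 := congrArg derivative ih
    simp only [derivative_mul, derivative_sub, derivative_X_pow, derivative_one, derivative_X,
      derivative_C, derivative_add, derivative_zero, ← Function.iterate_succ_apply' (f := derivative)] at h2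
    push_cast
    simp only [map_mul, map_sub, map_add, map_one, map_ofNat, map_natCast, map_zero, Nat.cast_ofNat] at h2 ⊢
    simp only [Nat.succ_eq_add_one] at h2
    have e1 : j + 1 + 2 = j + 2 + 1 := by ring
    have e2 : j + 1 + 1 = j + 2 := by ring
    simp only [e1, e2] at h2 ⊢
    linear_combination h2

lemma Qp_ode (k m : ℕ) (t : ℝ) :
    (1 - t ^ 2) * (Qp k (m + 2)).eval t - 2 * (m + 1) * t * (Qp k (m + 1)).eval t
      + ((k : ℝ) - m) * (k + m + 1) * (Qp k m).eval t = 0 := by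
  have h := congrArg (Polynomial.eval t) (R_ode k (k + m))
  simp only [Polynomial.eval_add, Polynomial.eval_mul, Polynomial.eval_sub, Polynomial.eval_pow,
    Polynomial.eval_X, Polynomial.eval_one, Polynomial.eval_C, Polynomial.eval_zero] at h
  simp only [Qp, Polynomial.eval_mul, Polynomial.eval_C]
  push_cast at h
  have e1 : k + (m + 2) = k + m + 2 := by ring
  have e2 : k + (m + 1) = k + m + 1 := by ring
  rw [e1, e2]
  linear_combination (-(1 / (2 ^ k * k.factorial : ℝ))) * h

lemma Qp_hasDeriv (k m : ℕ) (t : ℝ) :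
    HasDerivAt (fun t => (Qp k m).eval t) ((Qp k (m + 1)).eval t) t := by
  rw [← Qp_deriv]; exact Polynomial.hasDerivAt _ _

lemma Qp_cont (k m : ℕ) : Continuous (fun t => (Qp k m).eval t) := Polynomial.continuous _

lemma hasDeriv_w (t : ℝ) (m : ℕ) : HasDerivAt (fun t : ℝ => (1 - t ^ 2) ^ m)
    ((m : ℝ) * (1 - t ^ 2) ^ (m - 1) * (-(2 * t))) t := by
  have h : HasDerivAt (fun t : ℝ => 1 - t ^ 2) (-(2 * t)) t := by
    refine (HasDerivAt.const_sub (1 : ℝ) (hasDerivAt_pow 2 t)).congr_deriv ?_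
    simp
  exact h.fun_pow m

/-- The weighted norm integral. -/
def Iint (k m : ℕ) : ℝ := ∫ t in (-1 : ℝ)..1, (1 - t ^ 2) ^ m * (Qp k m).eval t ^ 2

lemma Iint_succ (k m : ℕ) : Iint k (m + 1) = ((k : ℝ) - m) * (k + m + 1) * Iint k m := by
  have hd : ∀ t ∈ Set.uIcc (-1 : ℝ) 1, HasDerivAt
      (fun t => (1 - t ^ 2) ^ (m + 1) * (Qp k (m + 1)).eval t * (Qp k m).eval t)
      ((1 - t ^ 2) ^ (m + 1) * (Qp k (m + 1)).eval t ^ 2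
        - ((k : ℝ) - m) * (k + m + 1) * ((1 - t ^ 2) ^ m * (Qp k m).eval t ^ 2)) t := by
    intro t _
    have h1 : HasDerivAt (fun t : ℝ => (1 - t ^ 2) ^ (m + 1))
        (((m + 1 : ℕ) : ℝ) * (1 - t ^ 2) ^ m * (-(2 * t))) t := by
      simpa using hasDeriv_w t (m + 1)
    have := (h1.fun_mul (Qp_hasDeriv k (m + 1) t)).fun_mul (Qp_hasDeriv k m t)
    refine HasDerivAt.congr_deriv this ?_
    have h := Qp_ode k m t
    push_cast
    linear_combination ((1 - t ^ 2) ^ m * (Qp k m).eval t) * h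
  have c := Qp_cont k m
  have c' := Qp_cont k (m + 1)
  have := intervalIntegral.integral_eq_sub_of_hasDerivAt hd
    (by apply Continuous.intervalIntegrable; fun_prop)
  rw [intervalIntegral.integral_sub (by apply Continuous.intervalIntegrable; fun_prop)
    (by apply Continuous.intervalIntegrable; fun_prop), intervalIntegral.integral_const_mul] at this
  norm_num at this
  rw [Iint, Iint]
  linarith

lemma Jint (k : ℕ) : ∫ t in (-1 : ℝ)..1, (1 - t ^ 2) ^ k
    = 2 ^ (2 * k + 1) * (k.factorial : ℝ) ^ 2 / ((2 * k + 1).factorial : ℝ) := by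
  induction k with
  | zero => norm_num
  | succ k ih =>
    have hd : ∀ t ∈ Set.uIcc (-1 : ℝ) 1, HasDerivAt
        (fun t : ℝ => t * (1 - t ^ 2) ^ (k + 1))
        ((2 * k + 3) * (1 - t ^ 2) ^ (k + 1) - (2 * (k + 1)) * (1 - t ^ 2) ^ k) t := by
      intro t _
      have h1 : HasDerivAt (fun t : ℝ => (1 - t ^ 2) ^ (k + 1))
          (((k + 1 : ℕ) : ℝ) * (1 - t ^ 2) ^ k * (-(2 * t))) t := by
        simpa using hasDeriv_w t (k + 1)
      have := (hasDerivAt_id' t).fun_mul h1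
      refine HasDerivAt.congr_deriv this ?_
      push_cast
      ring
    have := intervalIntegral.integral_eq_sub_of_hasDerivAt hd
      (by apply Continuous.intervalIntegrable; fun_prop)
    rw [intervalIntegral.integral_sub (by apply Continuous.intervalIntegrable; fun_prop)
      (by apply Continuous.intervalIntegrable; fun_prop), intervalIntegral.integral_const_mul,
      intervalIntegral.integral_const_mul, ih] at this
    norm_num at this
    have e : (2 * (k + 1) + 1).factorial = (2 * k + 3) * ((2 * k + 2) * (2 * k + 1).factorial) := by
      rw [show 2 * (k + 1) + 1 = (2 * k + 2) + 1 by ring, Nat.factorial_succ, Nat.factorial_succ]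
    rw [e, Nat.factorial_succ]
    have hp : ((2 * k + 1).factorial : ℝ) ≠ 0 := by positivity
    have hp2 : (2 * (k : ℝ) + 3) ≠ 0 := by positivity
    have : ∫ t in (-1 : ℝ)..1, (1 - t ^ 2) ^ (k + 1) = (2 * (k + 1)) / (2 * k + 3) *
      (2 ^ (2 * k + 1) * (k.factorial : ℝ) ^ 2 / ((2 * k + 1).factorial : ℝ)) := by
      rw [div_mul_eq_mul_div, eq_div_iff hp2]; linarith
    rw [this]
    push_cast
    field_simp
    ring

open Polynomial in
lemma Qp_top (k : ℕ) : Qp k k = C (((2 * k).factorial : ℝ) / (2 ^ k * k.factorial)) := by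
  have hm : ((X ^ 2 - 1 : ℝ[X]) ^ k).Monic := by
    apply Monic.pow
    exact monic_X_pow_sub_C 1 two_ne_zero
  have hdeg : ((X ^ 2 - 1 : ℝ[X]) ^ k).natDegree = 2 * k := by
    rw [natDegree_pow, show (X ^ 2 - 1 : ℝ[X]) = X ^ 2 - C 1 by simp, natDegree_X_pow_sub_C]
    ring
  have : derivative^[k + k] ((X ^ 2 - 1 : ℝ[X]) ^ k) = C ((2 * k).factorial : ℝ) := by
    have hle : (derivative^[k + k] ((X ^ 2 - 1 : ℝ[X]) ^ k)).natDegree ≤ 0 := by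
      refine (natDegree_iterate_derivative _ _).trans ?_
      rw [hdeg]; omega
    rw [eq_C_of_natDegree_le_zero hle, coeff_iterate_derivative]
    have hc : ((X ^ 2 - 1 : ℝ[X]) ^ k).coeff (k + k) = 1 := by
      have := hm.coeff_natDegree
      rwa [hdeg, two_mul] at this
    rw [zero_add, hc, Nat.descFactorial_self, two_mul]
    simp
  rw [Qp, this, ← C_mul]
  congr 1
  ring

lemma Iint_fac (k m : ℕ) (h : m ≤ k) :
    Iint k m * ((k - m).factorial : ℝ) = Iint k 0 * ((k + m).factorial : ℝ) := by
  induction m with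
  | zero => simp
  | succ m ih =>
    have ih := ih (by omega)
    obtain ⟨d, rfl⟩ : ∃ d, k = m + 1 + d := ⟨k - (m + 1), by omega⟩
    rw [show m + 1 + d - m = d + 1 by omega, Nat.factorial_succ] at ih
    rw [Iint_succ, show m + 1 + d - (m + 1) = d by omega,
      show m + 1 + d + (m + 1) = (m + 1 + d + m) + 1 by omega, Nat.factorial_succ]
    push_cast at ih ⊢
    linear_combination ((m : ℝ) + 1 + d + m + 1) * ih

lemma Iint_top (k : ℕ) : Iint k k = (((2 * k).factorial : ℝ) / (2 ^ k * k.factorial)) ^ 2 *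
    (2 ^ (2 * k + 1) * (k.factorial : ℝ) ^ 2 / ((2 * k + 1).factorial : ℝ)) := by
  rw [Iint, Qp_top, ← Jint, ← intervalIntegral.integral_const_mul]
  congr 1
  ext t
  simp
  ring

lemma Iint_eq (k m : ℕ) (h : m ≤ k) :
    Iint k m = 2 / (2 * k + 1) * ((k + m).factorial : ℝ) / ((k - m).factorial : ℝ) := by
  have h1 := Iint_fac k m h
  have h2 := Iint_fac k k le_rfl
  rw [Iint_top, Nat.sub_self, Nat.factorial_succ, ← two_mul] at h2
  have hz : Iint k 0 = 2 / (2 * k + 1) := by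
    have : ((2 * k).factorial : ℝ) ≠ 0 := by positivity
    have h3 : (k.factorial : ℝ) ≠ 0 := by positivity
    apply mul_right_cancel₀ this
    rw [← h2]
    push_cast
    field_simp
    simp
    ring
  rw [hz] at h1
  rw [eq_div_iff (by positivity), h1]

/-- The theta-density of the squared gradient (in `t = cos θ`), integrated over the azimuth. -/
lemma F_int (k m : ℕ) (N : ℝ) (hN : N ^ 2 + (k : ℝ) * (k + 1) = N * (2 * N + 1)) :
    ∫ t in (-1 : ℝ)..1, ((1 - t ^ 2) ^ m * (((N - m) ^ 2 + 2 * m * (N - m)) * (Qp k m).eval t ^ 2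
      + (1 - t ^ 2) * (Qp k (m + 1)).eval t ^ 2
      - 2 * m * t * (Qp k m).eval t * (Qp k (m + 1)).eval t)
      + 2 * (m : ℝ) ^ 2 * (1 - t ^ 2) ^ (m - 1) * (Qp k m).eval t ^ 2)
      = N * (2 * N + 1) * Iint k m := by
  have hd : ∀ t ∈ Set.uIcc (-1 : ℝ) 1, HasDerivAt
      (fun t => (1 - t ^ 2) ^ (m + 1) * (Qp k (m + 1)).eval t * (Qp k m).eval t
        - m * (t * (1 - t ^ 2) ^ m * (Qp k m).eval t ^ 2))
      (((1 - t ^ 2) ^ m * (((N - m) ^ 2 + 2 * m * (N - m)) * (Qp k m).eval t ^ 2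
      + (1 - t ^ 2) * (Qp k (m + 1)).eval t ^ 2
      - 2 * m * t * (Qp k m).eval t * (Qp k (m + 1)).eval t)
      + 2 * (m : ℝ) ^ 2 * (1 - t ^ 2) ^ (m - 1) * (Qp k m).eval t ^ 2)
        - N * (2 * N + 1) * ((1 - t ^ 2) ^ m * (Qp k m).eval t ^ 2)) t := by
    intro t _
    have h1 : ∀ m : ℕ, HasDerivAt (fun t : ℝ => (1 - t ^ 2) ^ m)
        ((m : ℝ) * (1 - t ^ 2) ^ (m - 1) * (-(2 * t))) t := by
      intro m
      exact hasDeriv_w t m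
    have := (((h1 (m + 1)).fun_mul (Qp_hasDeriv k (m + 1) t)).fun_mul (Qp_hasDeriv k m t)).fun_sub
      ((((hasDerivAt_id' t).fun_mul (h1 m)).fun_mul ((Qp_hasDeriv k m t).fun_pow 2)).const_mul (m : ℝ))
    refine HasDerivAt.congr_deriv this ?_
    have h := Qp_ode k m t
    rw [← hN]
    push_cast
    cases m with
    | zero =>
      simp at h ⊢
      linear_combination ((Qp k 0).eval t) * h
    | succ m =>
      simp only [Nat.add_sub_cancel] at h ⊢
      push_cast at h ⊢
      linear_combination ((1 - t ^ 2) ^ (m + 1) * (Qp k (m + 1)).eval t) * h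
  have c := Qp_cont k m
  have c' := Qp_cont k (m + 1)
  have := intervalIntegral.integral_eq_sub_of_hasDerivAt hd
    (by apply Continuous.intervalIntegrable; fun_prop)
  rw [intervalIntegral.integral_sub (by apply Continuous.intervalIntegrable; fun_prop)
    (by apply Continuous.intervalIntegrable; fun_prop), intervalIntegral.integral_const_mul] at this
  rw [Iint, ← sub_eq_zero, this]
  cases m <;> simp

open scoped ENNReal in
lemma sph_mp : MeasurePreserving
    (fun p : ℝ × (ℝ × ℝ) => (!₂[p.1, p.2.1, p.2.2] : E3)) volume volume := by
  have h1 := (PiLp.volume_preserving_toLp (Fin 3))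
  have h2 := (volume_preserving_piFinSuccAbove (fun _ : Fin 3 => ℝ) 0).symm
  have h3 := (volume_preserving_finTwoArrow ℝ).symm
  have h4 := (MeasurePreserving.id (volume : Measure ℝ)).prod h3
  have := (h1.comp h2).comp h4
  have he : (fun p : ℝ × (ℝ × ℝ) => (!₂[p.1, p.2.1, p.2.2] : E3)) =
    ((WithLp.toLp 2 ∘ ⇑(MeasurableEquiv.piFinSuccAbove (fun x => ℝ) 0).symm) ∘
      Prod.map id ⇑MeasurableEquiv.finTwoArrow.symm) := by
    funext p
    apply PiLp.ext
    intro i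
    fin_cases i <;> rfl
  rw [he]
  exact this

open scoped ENNReal in
theorem sph_lint (f : E3 → ℝ≥0∞) (hf : Measurable f) :
    ∫⁻ x, f x = ∫⁻ φ in Set.Ioo (-π) π, ∫⁻ ρ in Set.Ioi (0 : ℝ), ∫⁻ θ in Set.Ioo 0 π,
      ENNReal.ofReal (ρ ^ 2 * sin θ) *
        f (!₂[ρ * cos θ, ρ * sin θ * cos φ, ρ * sin θ * sin φ]) := by
  rw [← sph_mp.lintegral_comp hf]
  have hg : Measurable (fun p : ℝ × (ℝ × ℝ) => f (!₂[p.1, p.2.1, p.2.2] : E3)) :=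
    hf.comp sph_mp.measurable
  set g : ℝ × (ℝ × ℝ) → ℝ≥0∞ := fun p => f (!₂[p.1, p.2.1, p.2.2] : E3) with hgdef
  rw [Measure.volume_eq_prod, lintegral_prod _ hg.aemeasurable]
  have step1 : ∀ x : ℝ, ∫⁻ y : ℝ × ℝ, g (x, y) =
      ∫⁻ φ in Set.Ioo (-π) π, ∫⁻ r in Set.Ioi (0 : ℝ),
        ENNReal.ofReal r * g (x, (r * cos φ, r * sin φ)) := by
    intro x
    rw [← lintegral_comp_polarCoord_symm, polarCoord_target, Measure.volume_eq_prod,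
      ← Measure.prod_restrict, lintegral_prod_symm]
    · rfl
    · apply Measurable.aemeasurable
      simp only [polarCoord_symm_apply, smul_eq_mul]
      fun_prop
  simp_rw [step1]
  rw [lintegral_lintegral_swap]
  swap
  · apply Measurable.aemeasurable
    apply Measurable.lintegral_prod_right' (f := fun q : (ℝ × ℝ) × ℝ =>
      ENNReal.ofReal q.2 * g (q.1.1, (q.2 * cos q.1.2, q.2 * sin q.1.2)))
    fun_prop
  refine lintegral_congr fun φ => ?_
  have step2 : ∫⁻ x : ℝ, ∫⁻ r in Set.Ioi (0 : ℝ),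
        ENNReal.ofReal r * g (x, (r * cos φ, r * sin φ)) =
      ∫⁻ p : ℝ × ℝ, (Set.Ioi (0 : ℝ)).indicator (fun r =>
        ENNReal.ofReal r * g (p.1, (r * cos φ, r * sin φ))) p.2 := by
    rw [Measure.volume_eq_prod, lintegral_prod]
    · refine lintegral_congr fun x => ?_
      rw [← lintegral_indicator measurableSet_Ioi]
    · apply Measurable.aemeasurable
      have : (fun p : ℝ × ℝ => (Set.Ioi (0 : ℝ)).indicator (fun r =>
        ENNReal.ofReal r * g (p.1, (r * cos φ, r * sin φ))) p.2) =
        (Prod.snd ⁻¹' (Set.Ioi (0 : ℝ))).indicator (fun p : ℝ × ℝ =>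
        ENNReal.ofReal p.2 * g (p.1, (p.2 * cos φ, p.2 * sin φ))) := by
        ext p; simp [Set.indicator]
      rw [this]
      apply Measurable.indicator
      · fun_prop
      · exact measurable_snd measurableSet_Ioi
  rw [step2, ← lintegral_comp_polarCoord_symm, polarCoord_target, Measure.volume_eq_prod,
      ← Measure.prod_restrict, lintegral_prod]
  swap
  · apply Measurable.aemeasurable
    simp only [polarCoord_symm_apply, smul_eq_mul]
    have : (fun p : ℝ × ℝ => ENNReal.ofReal p.1 * (Set.Ioi (0 : ℝ)).indicator (fun r =>
        ENNReal.ofReal r * g (p.1 * cos p.2, (r * cos φ, r * sin φ))) (p.1 * sin p.2)) =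
        fun p => ENNReal.ofReal p.1 *
          ((fun p : ℝ × ℝ => p.1 * sin p.2) ⁻¹' (Set.Ioi (0 : ℝ))).indicator (fun p : ℝ × ℝ =>
        ENNReal.ofReal (p.1 * sin p.2) *
          g (p.1 * cos p.2, (p.1 * sin p.2 * cos φ, p.1 * sin p.2 * sin φ))) p := by
      ext p; simp [Set.indicator]
    rw [this]
    apply Measurable.mul (by fun_prop)
    apply Measurable.indicator
    · fun_prop
    · have : Measurable (fun p : ℝ × ℝ => p.1 * sin p.2) := by fun_prop
      exact this measurableSet_Ioi
  refine setLIntegral_congr_fun measurableSet_Ioi fun ρ hρ => ?_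
  have hρ : 0 < ρ := hρ
  simp only [polarCoord_symm_apply, smul_eq_mul]
  rw [← lintegral_indicator measurableSet_Ioo, ← lintegral_indicator measurableSet_Ioo]
  refine lintegral_congr fun θ => ?_
  by_cases h1 : θ ∈ Set.Ioo 0 π
  · have hs : 0 < sin θ := sin_pos_of_mem_Ioo h1
    have h2 : θ ∈ Set.Ioo (-π) π := ⟨by linarith [h1.1, pi_pos], h1.2⟩
    rw [Set.indicator_of_mem h1, Set.indicator_of_mem h2, Set.indicator_of_mem (by simp; positivity),
      ← mul_assoc, ← ENNReal.ofReal_mul hρ.le]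
    simp only [hgdef]
    congr 2
    ring
  · rw [Set.indicator_of_notMem h1]
    by_cases h2 : θ ∈ Set.Ioo (-π) π
    · rw [Set.indicator_of_mem h2, Set.indicator_of_notMem, mul_zero]
      have : sin θ ≤ 0 := by
        apply sin_nonpos_of_nonpos_of_neg_pi_le _ h2.1.le
        by_contra h
        exact h1 ⟨not_le.1 h, h2.2⟩
      simp
      exact mul_nonpos_of_nonneg_of_nonpos hρ.le this
    · rw [Set.indicator_of_notMem h2]

/-- The complex number `x₁ + i x₂`. -/
def zc (x : E3) : ℂ := ⟨x 1, x 2⟩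

/-- real or imaginary part -/
def reim (sgn : Bool) (z : ℂ) : ℝ := if sgn then z.re else z.im

/-- real or imaginary part, as a continuous linear map -/
def reimL (sgn : Bool) : ℂ →L[ℝ] ℝ := if sgn then Complex.reCLM else Complex.imCLM

lemma reimL_apply (sgn : Bool) (z : ℂ) : reimL sgn z = reim sgn z := by
  cases sgn <;> simp [reimL, reim]

/-- `zc` as a continuous linear map -/
def zcL : E3 →L[ℝ] ℂ :=
  (EuclideanSpace.proj (1 : Fin 3) : E3 →L[ℝ] ℝ).smulRight (1 : ℂ) +
  (EuclideanSpace.proj (2 : Fin 3) : E3 →L[ℝ] ℝ).smulRight Complex.I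

lemma zcL_apply (x : E3) : zcL x = zc x := by
  apply Complex.ext <;> simp [zcL, zc]

/-- The planar harmonic factor. -/
def Wf (m : ℕ) (sgn : Bool) (x : E3) : ℝ := reim sgn (zc x ^ m)

/-- derivative of the planar harmonic factor -/
def dW (m : ℕ) (sgn : Bool) (x : E3) : E3 →L[ℝ] ℝ :=
  (reimL sgn).comp (((ContinuousLinearMap.toSpanSingleton ℂ
    ((m : ℂ) * zc x ^ (m - 1))).restrictScalars ℝ).comp zcL)

lemma hasF_W (m : ℕ) (sgn : Bool) (x : E3) : HasFDerivAt (Wf m sgn) (dW m sgn x) x := by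
  have h1 : HasFDerivAt (fun x : E3 => zcL x) zcL x := zcL.hasFDerivAt
  have h2 := ((hasDerivAt_pow m (zcL x)).hasFDerivAt.restrictScalars ℝ).comp x h1
  have h3 := ((reimL sgn).hasFDerivAt).comp x h2
  rw [dW, ← zcL_apply]
  refine h3.congr_of_eventuallyEq (Filter.Eventually.of_forall fun y => ?_)
  simp [Wf, reimL_apply, zcL_apply]

lemma dW_apply (m : ℕ) (sgn : Bool) (x v : E3) :
    dW m sgn x v = reim sgn (zc v * ((m : ℂ) * zc x ^ (m - 1))) := by
  simp [dW, reimL_apply, zcL_apply]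

lemma dW_zero (m : ℕ) (sgn : Bool) (x : E3) : dW m sgn x (EuclideanSpace.single 0 1) = 0 := by
  have : zc (EuclideanSpace.single 0 1) = 0 := by
    apply Complex.ext <;> simp [zc]
  rw [dW_apply, this]
  cases sgn <;> simp [reim]

lemma zc_one : zc (EuclideanSpace.single 1 1) = 1 := by
  apply Complex.ext <;> simp [zc]

lemma zc_two : zc (EuclideanSpace.single 2 1) = Complex.I := by
  apply Complex.ext <;> simp [zc]

lemma dW_euler (m : ℕ) (sgn : Bool) (x : E3) :
    x 1 * dW m sgn x (EuclideanSpace.single 1 1) + x 2 * dW m sgn x (EuclideanSpace.single 2 1)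
      = m * Wf m sgn x := by
  rw [dW_apply, dW_apply, zc_one, zc_two, Wf]
  have h : (m : ℂ) * zc x ^ m = zc x * ((m : ℂ) * zc x ^ (m - 1)) := by
    cases m with
    | zero => simp
    | succ m => simp only [Nat.add_sub_cancel]; ring
  have h1 : (m : ℝ) * reim sgn (zc x ^ m) = reim sgn ((m : ℂ) * zc x ^ m) := by
    cases sgn <;> simp [reim]
  rw [h1, h]
  generalize (m : ℂ) * zc x ^ (m - 1) = w
  cases sgn <;> simp [reim, zc] <;> ring

lemma dW_sq (m : ℕ) (sgn : Bool) (x : E3) :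
    dW m sgn x (EuclideanSpace.single 1 1) ^ 2 + dW m sgn x (EuclideanSpace.single 2 1) ^ 2
      = (m : ℝ) ^ 2 * (x 1 ^ 2 + x 2 ^ 2) ^ (m - 1) := by
  rw [dW_apply, dW_apply, zc_one, zc_two]
  have h : (m : ℝ) ^ 2 * (x 1 ^ 2 + x 2 ^ 2) ^ (m - 1)
      = Complex.normSq ((m : ℂ) * zc x ^ (m - 1)) := by
    rw [map_mul, map_pow, Complex.normSq_natCast, Complex.normSq_apply (zc x)]
    simp [zc, pow_two]
  rw [h]
  generalize (m : ℂ) * zc x ^ (m - 1) = w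
  rw [Complex.normSq_apply]
  cases sgn <;> simp [reim] <;> ring

lemma sphRho_eq (x : E3) : sphRho x = ‖x‖ := by
  rw [sphRho, EuclideanSpace.norm_eq]
  simp [Fin.sum_univ_three]

lemma sphRho_pos {x : E3} (hx : x ≠ 0) : 0 < sphRho x := by
  rw [sphRho_eq]; exact norm_pos_iff.2 hx

lemma sphRho_sq (x : E3) : sphRho x ^ 2 = x 0 ^ 2 + x 1 ^ 2 + x 2 ^ 2 := by
  rw [sphRho, sq_sqrt (by positivity)]

/-- coordinate functional -/
def pr (i : Fin 3) : E3 →L[ℝ] ℝ := EuclideanSpace.proj i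

lemma pr_apply (i : Fin 3) (x : E3) : pr i x = x i := rfl

/-- derivative of the radius -/
def dRho (x : E3) : E3 →L[ℝ] ℝ := (1 / sphRho x) • (x 0 • pr 0 + x 1 • pr 1 + x 2 • pr 2)

lemma hasF_rho {x : E3} (hx : x ≠ 0) : HasFDerivAt sphRho (dRho x) x := by
  have hp : ∀ i, HasFDerivAt (fun x : E3 => x i) (pr i) x := fun i => (pr i).hasFDerivAt
  have h := (((hp 0).pow 2).add ((hp 1).pow 2)).add ((hp 2).pow 2)
  have hpos := sphRho_pos hx
  have hne : x 0 ^ 2 + x 1 ^ 2 + x 2 ^ 2 ≠ 0 := by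
    rw [← sphRho_sq]; positivity
  have := h.sqrt hne
  refine this.congr_fderiv ?_
  ext v
  simp [dRho, pr_apply, sphRho]
  ring

/-- The explicit solid harmonic off the origin. -/
def Uex (k : ℕ) (a : ℤ) (m : ℕ) (sgn : Bool) (x : E3) : ℝ :=
  sphRho x ^ a * (Qp k m).eval (x 0 / sphRho x) * Wf m sgn x

lemma hasF_U (k : ℕ) (a : ℤ) (m : ℕ) (sgn : Bool) {x : E3} (hx : x ≠ 0) :
    ∃ D : E3 →L[ℝ] ℝ, HasFDerivAt (Uex k a m sgn) D x ∧ ∀ v, D v =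
      (a * (sphRho x ^ a / sphRho x) * dRho x v * (Qp k m).eval (x 0 / sphRho x)
        + sphRho x ^ a * ((Qp k (m + 1)).eval (x 0 / sphRho x) *
          (v 0 / sphRho x - x 0 * dRho x v / sphRho x ^ 2))) * Wf m sgn x
      + sphRho x ^ a * (Qp k m).eval (x 0 / sphRho x) * dW m sgn x v := by
  have hpos := sphRho_pos hx
  have h1 : HasFDerivAt (fun x => sphRho x ^ a) _ x :=
    (hasDerivAt_zpow a (sphRho x) (Or.inl hpos.ne')).comp_hasFDerivAt x (hasF_rho hx)
  have hp : HasFDerivAt (fun x : E3 => x 0) (pr 0) x := (pr 0).hasFDerivAt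
  have h2 : HasFDerivAt (fun x : E3 => x 0 / sphRho x) _ x :=
    hp.fun_mul ((hasDerivAt_inv hpos.ne').comp_hasFDerivAt x (hasF_rho hx))
  have h3 : HasFDerivAt (fun x : E3 => (Qp k m).eval (x 0 / sphRho x)) _ x :=
    HasDerivAt.comp_hasFDerivAt (h₂ := fun t => (Qp k m).eval t) x (Qp_hasDeriv k m (x 0 / sphRho x)) h2
  refine ⟨_, (h1.fun_mul h3).fun_mul (hasF_W m sgn x), fun v => ?_⟩
  simp [pr_apply, zpow_sub_one₀ hpos.ne']
  field_simp
  ring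

lemma dRho_single (x : E3) (i : Fin 3) :
    dRho x (EuclideanSpace.single i 1) = x i / sphRho x := by
  fin_cases i <;> simp [dRho, pr_apply] <;> ring

lemma grad_sq (k : ℕ) (a : ℤ) (m : ℕ) (sgn : Bool) {x : E3} (hx : x ≠ 0) :
    ∃ D : E3 →L[ℝ] ℝ, HasFDerivAt (Uex k a m sgn) D x ∧
      D (EuclideanSpace.single 0 1) ^ 2 + D (EuclideanSpace.single 1 1) ^ 2
        + D (EuclideanSpace.single 2 1) ^ 2 =
      (sphRho x ^ a / sphRho x) ^ 2 * (Wf m sgn x ^ 2 *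
        ((a : ℝ) ^ 2 * (Qp k m).eval (x 0 / sphRho x) ^ 2
          + (1 - (x 0 / sphRho x) ^ 2) * (Qp k (m + 1)).eval (x 0 / sphRho x) ^ 2
          + 2 * m * (Qp k m).eval (x 0 / sphRho x) * (a * (Qp k m).eval (x 0 / sphRho x)
            - (x 0 / sphRho x) * (Qp k (m + 1)).eval (x 0 / sphRho x))))
      + (sphRho x ^ a) ^ 2 * (Qp k m).eval (x 0 / sphRho x) ^ 2 *
          ((m : ℝ) ^ 2 * (x 1 ^ 2 + x 2 ^ 2) ^ (m - 1)) := by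
  obtain ⟨D, hD, h⟩ := hasF_U k a m sgn hx
  refine ⟨D, hD, ?_⟩
  have hpos := sphRho_pos hx
  have hsq := sphRho_sq x
  have he := dW_euler m sgn x
  rw [← dW_sq m sgn x]
  have s0 : (EuclideanSpace.single (0 : Fin 3) (1 : ℝ) : E3) 0 = 1 := by simp
  have s1 : (EuclideanSpace.single (1 : Fin 3) (1 : ℝ) : E3) 0 = 0 := by simp
  have s2 : (EuclideanSpace.single (2 : Fin 3) (1 : ℝ) : E3) 0 = 0 := by simp
  simp only [h, dRho_single, dW_zero, s0, s1, s2]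
  clear s0 s1 s2
  generalize dW m sgn x (EuclideanSpace.single 1 1) = w1 at *
  generalize dW m sgn x (EuclideanSpace.single 2 1) = w2 at *
  generalize Wf m sgn x = W at *
  obtain ⟨t, ht⟩ : ∃ t, t = x 0 / sphRho x := ⟨_, rfl⟩
  have hx0 : x 0 = t * sphRho x := by rw [ht]; field_simp
  rw [← ht]
  generalize (Qp k m).eval t = q at *
  generalize (Qp k (m + 1)).eval t = q' at *
  generalize sphRho x ^ a = A at *
  generalize sphRho x = ρ at *
  obtain ⟨B, hB⟩ : ∃ B, B = A / ρ := ⟨_, rfl⟩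
  obtain ⟨y, hy⟩ : ∃ y, y = x 1 / ρ := ⟨_, rfl⟩
  obtain ⟨z, hz⟩ : ∃ z, z = x 2 / ρ := ⟨_, rfl⟩
  have hA : A = B * ρ := by rw [hB]; field_simp
  have hx1 : x 1 = y * ρ := by rw [hy]; field_simp
  have hx2 : x 2 = z * ρ := by rw [hz]; field_simp
  rw [hx0, hx1, hx2] at hsq
  rw [hx1, hx2] at he
  rw [hx0, hx1, hx2, hA]
  have hyz : t ^ 2 + y ^ 2 + z ^ 2 = 1 := by
    have : ρ ^ 2 ≠ 0 := by positivity
    apply mul_left_cancel₀ this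
    linarith
  clear h hD hx0 ht hA hx1 hx2 hB hy hz
  have e0 : (a * (B * ρ / ρ) * t * q + B * ρ * (q' * (1 / ρ - t * ρ * t / ρ ^ 2))) * W + B * ρ * q * 0
      = B * (a * t * q + q' * (1 - t ^ 2)) * W := by
    field_simp
    ring
  have e1 : ∀ y w, (a * (B * ρ / ρ) * (y * ρ / ρ) * q + B * ρ * (q' * (0 / ρ - t * ρ * (y * ρ / ρ) / ρ ^ 2))) * W
      + B * ρ * q * w = B * ((a * q - t * q') * y * W + ρ * q * w) := by
    intro y w
    field_simp
    ring
  have e2 : B * ρ / ρ = B := by field_simp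
  rw [e0, e1, e1, e2]
  linear_combination (B ^ 2 * W ^ 2 * (a * q - t * q') ^ 2) * hyz
    + 2 * B ^ 2 * (a * q - t * q') * W * q * he

/-- Relation between the integer degree and the degree of the Legendre polynomial. -/
def degRel (N : ℤ) (k : ℕ) : Prop := (0 ≤ N ∧ (k : ℤ) = N) ∨ (N < 0 ∧ (k : ℤ) = -N - 1)

lemma assocLegendre_eq {N : ℤ} {k : ℕ} (h : degRel N k) (m : ℕ) (t : ℝ) :
    assocLegendre N m t = (1 - t ^ 2) ^ ((m : ℝ) / 2) * (Qp k m).eval t := by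
  rcases h with ⟨h1, h2⟩ | ⟨h1, h2⟩
  · rw [assocLegendre, if_pos h1, ← h2, Int.toNat_natCast, assocLegendreNat, iter_leg]
  · rw [assocLegendre, if_neg (by omega), ← h2, Int.toNat_natCast, assocLegendreNat, iter_leg]

lemma reim_polar (r φ : ℝ) (m : ℕ) (sgn : Bool) :
    reim sgn (((r : ℂ) * (Complex.cos φ + Complex.sin φ * Complex.I)) ^ m)
      = r ^ m * PhiFac m sgn φ := by
  rw [mul_pow, Complex.cos_add_sin_mul_I_pow]
  have : (r : ℂ) ^ m * (Complex.cos (m * φ) + Complex.sin (m * φ) * Complex.I)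
      = ((r ^ m * cos (m * φ) : ℝ) : ℂ) + ((r ^ m * sin (m * φ) : ℝ) : ℂ) * Complex.I := by
    push_cast; ring
  rw [this]
  cases sgn
  · simp only [reim, PhiFac, Complex.add_im, Complex.ofReal_im, Complex.mul_im, Complex.ofReal_re,
      Complex.I_im, Complex.I_re]
    simp
  · simp only [reim, PhiFac, Complex.add_re, Complex.ofReal_im, Complex.mul_re, Complex.ofReal_re,
      Complex.I_im, Complex.I_re]
    simp

lemma Wf_eq (m : ℕ) (sgn : Bool) (x : E3) :
    Wf m sgn x = ‖zc x‖ ^ m * PhiFac m sgn (sphPhi x) := by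
  rw [← reim_polar, Wf]
  congr 2
  exact (Complex.norm_mul_cos_add_sin_mul_I (zc x)).symm

lemma solidU_eq {N : ℤ} {k : ℕ} (h : degRel N k) (m : ℕ) (sgn : Bool) {x : E3} (hx : x ≠ 0) :
    solidU N m sgn x = Uex k (N - m) m sgn x := by
  have hpos := sphRho_pos hx
  rw [solidU, Uex, assocLegendre_eq h, Wf_eq]
  have hsq := sphRho_sq x
  have hr : ‖zc x‖ ^ 2 = x 1 ^ 2 + x 2 ^ 2 := by
    rw [← Complex.normSq_eq_norm_sq, Complex.normSq_apply]; simp [zc, pow_two]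
  have h1 : 1 - (x 0 / sphRho x) ^ 2 = (‖zc x‖ / sphRho x) ^ 2 := by
    rw [div_pow, div_pow, hr]
    field_simp
    linarith
  have h2 : (1 - (x 0 / sphRho x) ^ 2) ^ ((m : ℝ) / 2) = (‖zc x‖ / sphRho x) ^ m := by
    rw [h1, ← rpow_natCast _ 2, ← rpow_mul (by positivity), ← rpow_natCast _ m]
    congr 1
    push_cast
    ring
  rw [h2, zpow_sub₀ hpos.ne', zpow_natCast, div_pow]
  field_simp

lemma Xmon_sq {n : ℤ} {k : ℕ} (h : degRel (n + 1) k) (m : ℕ) (sgn : Bool) {x : E3} (hx : x ≠ 0) :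
    qip (Xmon n m sgn x) (Xmon n m sgn x) =
      (sphRho x ^ (n + 1 - m) / sphRho x) ^ 2 * (Wf m sgn x ^ 2 *
        (((n + 1 - m : ℤ) : ℝ) ^ 2 * (Qp k m).eval (x 0 / sphRho x) ^ 2
          + (1 - (x 0 / sphRho x) ^ 2) * (Qp k (m + 1)).eval (x 0 / sphRho x) ^ 2
          + 2 * m * (Qp k m).eval (x 0 / sphRho x) *
            (((n + 1 - m : ℤ) : ℝ) * (Qp k m).eval (x 0 / sphRho x)
            - (x 0 / sphRho x) * (Qp k (m + 1)).eval (x 0 / sphRho x))))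
      + (sphRho x ^ (n + 1 - m)) ^ 2 * (Qp k m).eval (x 0 / sphRho x) ^ 2 *
          ((m : ℝ) ^ 2 * (x 1 ^ 2 + x 2 ^ 2) ^ (m - 1)) := by
  obtain ⟨D, hD, hs⟩ := grad_sq k (n + 1 - m) m sgn hx
  rw [← hs]
  have h1 : HasFDerivAt (solidU (n + 1) m sgn) D x := by
    refine hD.congr_of_eventuallyEq ?_
    filter_upwards [isOpen_ne.mem_nhds hx] with y hy
    exact solidU_eq h m sgn hy
  have h2 : HasFDerivAt (solidUq (n + 1) m sgn) ((algebraMapCLM ℝ H).comp D) x :=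
    (algebraMapCLM ℝ H).hasFDerivAt.comp x h1
  have h3 : ∀ i, pd i (solidUq (n + 1) m sgn) x = ((D (EuclideanSpace.single i 1) : ℝ) : H) := by
    intro i
    rw [pd, h2.fderiv]
    rfl
  rw [Xmon, Dop, h3, h3, h3]
  have a1 : qe1.re = 0 := rfl
  have a2 : qe1.imI = 1 := rfl
  have a3 : qe1.imJ = 0 := rfl
  have a4 : qe1.imK = 0 := rfl
  have b1 : qe2.re = 0 := rfl
  have b2 : qe2.imI = 0 := rfl
  have b3 : qe2.imJ = 1 := rfl
  have b4 : qe2.imK = 0 := rfl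
  simp [qip, a1, a2, a3, a4, b1, b2, b3, b4]
  ring

/-- Angular density. -/
def Sang (k m : ℕ) (a : ℝ) (sgn : Bool) (θ φ : ℝ) : ℝ :=
  sin θ ^ (2 * m) * PhiFac m sgn φ ^ 2 * (a ^ 2 * (Qp k m).eval (cos θ) ^ 2
    + sin θ ^ 2 * (Qp k (m + 1)).eval (cos θ) ^ 2
    + 2 * m * (Qp k m).eval (cos θ) * (a * (Qp k m).eval (cos θ)
      - cos θ * (Qp k (m + 1)).eval (cos θ)))
  + (m : ℝ) ^ 2 * sin θ ^ (2 * (m - 1)) * (Qp k m).eval (cos θ) ^ 2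

/-- spherical point -/
def sphPt (ρ θ φ : ℝ) : E3 := !₂[ρ * cos θ, ρ * sin θ * cos φ, ρ * sin θ * sin φ]

lemma sphRho_sphPt {ρ : ℝ} (hρ : 0 < ρ) (θ φ : ℝ) : sphRho (sphPt ρ θ φ) = ρ := by
  have : (ρ * cos θ) ^ 2 + (ρ * sin θ * cos φ) ^ 2 + (ρ * sin θ * sin φ) ^ 2 = ρ ^ 2 := by
    have h1 := sin_sq_add_cos_sq θ
    have h2 := sin_sq_add_cos_sq φ
    linear_combination ρ ^ 2 * h1 + ρ ^ 2 * sin θ ^ 2 * h2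
  simp [sphRho, sphPt, this, sqrt_sq hρ.le]

lemma Wf_sphPt (ρ θ φ : ℝ) (m : ℕ) (sgn : Bool) :
    Wf m sgn (sphPt ρ θ φ) = (ρ * sin θ) ^ m * PhiFac m sgn φ := by
  rw [← reim_polar, Wf]
  congr 2
  have h : zc (sphPt ρ θ φ) = ⟨ρ * sin θ * cos φ, ρ * sin θ * sin φ⟩ := by
    simp [zc, sphPt]
  rw [h]
  generalize ρ * sin θ = r
  rw [← Complex.ofReal_cos, ← Complex.ofReal_sin]
  apply Complex.ext
  · simp only [Complex.add_re, Complex.ofReal_im, Complex.mul_re, Complex.ofReal_re,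
      Complex.I_im, Complex.I_re, Complex.add_im, Complex.mul_im]
    ring
  · simp only [Complex.add_re, Complex.ofReal_im, Complex.mul_re, Complex.ofReal_re,
      Complex.I_im, Complex.I_re, Complex.add_im, Complex.mul_im]
    ring

lemma Xmon_sph {n : ℤ} {k : ℕ} (h : degRel (n + 1) k) (m : ℕ) (sgn : Bool) {ρ : ℝ} (hρ : 0 < ρ)
    (θ φ : ℝ) :
    qip (Xmon n m sgn (sphPt ρ θ φ)) (Xmon n m sgn (sphPt ρ θ φ)) =
      ρ ^ (2 * n) * Sang k m ((n : ℝ) + 1 - m) sgn θ φ := by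
  have hx : sphPt ρ θ φ ≠ 0 := by
    intro h0
    have := sphRho_sphPt hρ θ φ
    rw [h0, sphRho_eq, norm_zero] at this
    exact hρ.ne this
  rw [Xmon_sq h m sgn hx, sphRho_sphPt hρ, Wf_sphPt]
  have e0 : (sphPt ρ θ φ) 0 / ρ = cos θ := by
    simp [sphPt]; field_simp
  have e12 : (sphPt ρ θ φ) 1 ^ 2 + (sphPt ρ θ φ) 2 ^ 2 = ρ ^ 2 * sin θ ^ 2 := by
    have h2 := sin_sq_add_cos_sq φ
    simp [sphPt]
    linear_combination ρ ^ 2 * sin θ ^ 2 * h2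
  rw [e0, e12, Sang]
  have es : 1 - cos θ ^ 2 = sin θ ^ 2 := by linarith [sin_sq_add_cos_sq θ]
  rw [es]
  push_cast
  have p1 : (ρ ^ (n + 1 - (m : ℤ)) / ρ) = ρ ^ n / ρ ^ m := by
    rw [zpow_sub₀ hρ.ne', zpow_add_one₀ hρ.ne', zpow_natCast]
    field_simp
  have p2 : (ρ ^ (n + 1 - (m : ℤ))) = ρ ^ n * ρ / ρ ^ m := by
    rw [zpow_sub₀ hρ.ne', zpow_add_one₀ hρ.ne', zpow_natCast]
  have p3 : ρ ^ (2 * n) = (ρ ^ n) ^ 2 := by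
    rw [two_mul, zpow_add₀ hρ.ne']; ring
  rw [p1, p2, p3, mul_pow]
  generalize ρ ^ n = R
  cases m with
  | zero => simp
  | succ m =>
    simp only [Nat.add_sub_cancel]
    push_cast
    field_simp
    ring

lemma qip_measurable (n : ℤ) (m : ℕ) (sgn : Bool) :
    Measurable (fun x => qip (Xmon n m sgn x) (Xmon n m sgn x)) := by
  letI : MeasurableSpace H := borel H
  haveI : BorelSpace H := ⟨rfl⟩
  have hp : ∀ i, Measurable (pd i (solidUq (n + 1) m sgn)) := fun i =>
    measurable_fderiv_apply_const ℝ (solidUq (n + 1) m sgn) (EuclideanSpace.single i (1 : ℝ))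
  have hc : ∀ (c : H) (g : H → ℝ), Continuous g → ∀ i,
      Measurable (fun x => g (c * pd i (solidUq (n + 1) m sgn) x)) := fun c g hg i =>
    ((hg.comp (continuous_const.mul continuous_id)).measurable).comp (hp i)
  have hc0 : ∀ (g : H → ℝ), Continuous g → ∀ i,
      Measurable (fun x => g (pd i (solidUq (n + 1) m sgn) x)) := fun g hg i =>
    (hg.measurable).comp (hp i)
  have r1 := hc0 _ Quaternion.continuous_re 0
  have r2 := hc qe1 _ Quaternion.continuous_re 1
  have r3 := hc qe2 _ Quaternion.continuous_re 2
  have i1 := hc0 _ Quaternion.continuous_imI 0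
  have i2 := hc qe1 _ Quaternion.continuous_imI 1
  have i3 := hc qe2 _ Quaternion.continuous_imI 2
  have j1 := hc0 _ Quaternion.continuous_imJ 0
  have j2 := hc qe1 _ Quaternion.continuous_imJ 1
  have j3 := hc qe2 _ Quaternion.continuous_imJ 2
  simp only [qip, Xmon, Dop, Quaternion.re_sub, Quaternion.imI_sub, Quaternion.imJ_sub]
  fun_prop

lemma qip_nonneg (p : H) : 0 ≤ qip p p := by
  rw [qip]; nlinarith [mul_self_nonneg p.re, mul_self_nonneg p.imI, mul_self_nonneg p.imJ]

lemma Phi_int (m : ℕ) (sgn : Bool) (h0 : m = 0 → sgn = true) :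
    ∫ φ in (-π)..π, PhiFac m sgn φ ^ 2 = π * ((if m = 0 then (1 : ℝ) else 0) + 1) := by
  by_cases hm : m = 0
  · subst hm
    simp [PhiFac, h0 rfl]
    ring
  · have hm' : (m : ℝ) ≠ 0 := by exact_mod_cast hm
    rw [if_neg hm]
    cases sgn
    · simp only [PhiFac, Bool.false_eq_true, if_false]
      rw [intervalIntegral.integral_comp_mul_left (fun x => sin x ^ 2) hm', integral_sin_sq]
      simp [sin_nat_mul_pi]
      field_simp
    · simp only [PhiFac, if_true]
      rw [intervalIntegral.integral_comp_mul_left (fun x => cos x ^ 2) hm', integral_cos_sq]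
      simp [sin_nat_mul_pi]
      field_simp

lemma PhiFac_cont (m : ℕ) (sgn : Bool) : Continuous (PhiFac m sgn) := by
  cases sgn
  · have : PhiFac m false = fun φ => sin (m * φ) := by ext φ; simp [PhiFac]
    rw [this]; fun_prop
  · have : PhiFac m true = fun φ => cos (m * φ) := by ext φ; simp [PhiFac]
    rw [this]; fun_prop

/-- first theta integral -/
def alph (k m : ℕ) (a : ℝ) : ℝ := ∫ θ in (0 : ℝ)..π,
  sin θ * (sin θ ^ (2 * m) * (a ^ 2 * (Qp k m).eval (cos θ) ^ 2
    + sin θ ^ 2 * (Qp k (m + 1)).eval (cos θ) ^ 2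
    + 2 * m * (Qp k m).eval (cos θ) * (a * (Qp k m).eval (cos θ)
      - cos θ * (Qp k (m + 1)).eval (cos θ))))

/-- second theta integral -/
def bet (k m : ℕ) : ℝ := ∫ θ in (0 : ℝ)..π,
  sin θ * ((m : ℝ) ^ 2 * sin θ ^ (2 * (m - 1)) * (Qp k m).eval (cos θ) ^ 2)

lemma Qc_cont (k m : ℕ) : Continuous (fun θ => (Qp k m).eval (cos θ)) :=
  (Qp_cont k m).comp continuous_cos

lemma Sang_int (k m : ℕ) (a : ℝ) (sgn : Bool) (φ : ℝ) :
    ∫ θ in (0 : ℝ)..π, sin θ * Sang k m a sgn θ φ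
      = alph k m a * PhiFac m sgn φ ^ 2 + bet k m := by
  have c := Qc_cont k m
  have c' := Qc_cont k (m + 1)
  rw [alph, bet, ← intervalIntegral.integral_mul_const, ← intervalIntegral.integral_add
    (by apply Continuous.intervalIntegrable; fun_prop)
    (by apply Continuous.intervalIntegrable; fun_prop)]
  congr 1
  ext θ
  rw [Sang]
  ring

lemma alph_bet (k m : ℕ) (N : ℝ) (hN : N ^ 2 + (k : ℝ) * (k + 1) = N * (2 * N + 1)) :
    alph k m (N - m) + 2 * bet k m = N * (2 * N + 1) * Iint k m := by
  have c := Qc_cont k m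
  have c' := Qc_cont k (m + 1)
  have d := Qp_cont k m
  have d' := Qp_cont k (m + 1)
  rw [← F_int k m N hN]
  have := intervalIntegral.integral_comp_mul_deriv (a := 0) (b := π) (f := cos)
    (f' := fun θ => - sin θ) (g := fun t => ((1 - t ^ 2) ^ m *
      (((N - m) ^ 2 + 2 * m * (N - m)) * (Qp k m).eval t ^ 2
      + (1 - t ^ 2) * (Qp k (m + 1)).eval t ^ 2
      - 2 * m * t * (Qp k m).eval t * (Qp k (m + 1)).eval t)
      + 2 * (m : ℝ) ^ 2 * (1 - t ^ 2) ^ (m - 1) * (Qp k m).eval t ^ 2))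
      (fun x _ => hasDerivAt_cos x) (by fun_prop) (by fun_prop)
  rw [cos_zero, cos_pi, intervalIntegral.integral_symm (-1) 1] at this
  rw [← neg_eq_iff_eq_neg] at this
  rw [← this, alph, bet, ← intervalIntegral.integral_const_mul, ← intervalIntegral.integral_add
    (by apply Continuous.intervalIntegrable; fun_prop)
    (by apply Continuous.intervalIntegrable; fun_prop), ← intervalIntegral.integral_neg]
  congr 1
  ext θ
  have es : 1 - cos θ ^ 2 = sin θ ^ 2 := by linarith [sin_sq_add_cos_sq θ]
  simp only [Function.comp, es]
  ring

lemma lint_ofReal (f : ℝ → ℝ) (a b : ℝ) (hab : a ≤ b) (hf : Continuous f)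
    (h0 : ∀ x ∈ Set.Ioo a b, 0 ≤ f x) :
    ∫⁻ x in Set.Ioo a b, ENNReal.ofReal (f x) = ENNReal.ofReal (∫ x in a..b, f x) := by
  rw [intervalIntegral.integral_of_le hab, integral_Ioc_eq_integral_Ioo,
    ofReal_integral_eq_lintegral_ofReal]
  · exact (hf.integrableOn_Icc (a := a) (b := b)).mono_set Set.Ioo_subset_Icc_self
  · filter_upwards [ae_restrict_mem measurableSet_Ioo] with x hx using h0 x hx

lemma Sang_nonneg {n : ℤ} {k : ℕ} (h : degRel (n + 1) k) (m : ℕ) (sgn : Bool) (θ φ : ℝ) :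
    0 ≤ Sang k m ((n : ℝ) + 1 - m) sgn θ φ := by
  have := Xmon_sph h m sgn one_pos θ φ
  rw [one_zpow, one_mul] at this
  rw [← this]
  exact qip_nonneg _

lemma degRel_id {n : ℤ} {k : ℕ} (h : degRel (n + 1) k) :
    ((n : ℝ) + 1) ^ 2 + (k : ℝ) * (k + 1) = ((n : ℝ) + 1) * (2 * ((n : ℝ) + 1) + 1) := by
  rcases h with ⟨_, h⟩ | ⟨_, h⟩
  · have : (k : ℝ) = n + 1 := by exact_mod_cast h
    rw [this]; ring
  · have : (k : ℝ) = -(n + 1) - 1 := by exact_mod_cast h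
    rw [this]; ring

lemma zpow_meas (z : ℤ) : Measurable fun ρ : ℝ => ENNReal.ofReal (ρ ^ z) := by
  apply Measurable.ennreal_ofReal
  cases z with
  | ofNat j => simp only [Int.ofNat_eq_natCast, zpow_natCast]; fun_prop
  | negSucc j => simp only [zpow_negSucc]; fun_prop

lemma Sang_cont (k m : ℕ) (a : ℝ) (sgn : Bool) :
    Continuous fun p : ℝ × ℝ => sin p.2 * Sang k m a sgn p.2 p.1 := by
  have e := PhiFac_cont m sgn
  have c1 : Continuous fun p : ℝ × ℝ => (Qp k m).eval (cos p.2) :=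
    (Qc_cont k m).comp continuous_snd
  have c2 : Continuous fun p : ℝ × ℝ => (Qp k (m + 1)).eval (cos p.2) :=
    (Qc_cont k (m + 1)).comp continuous_snd
  simp only [Sang]
  fun_prop

lemma Sang_meas (k m : ℕ) (a : ℝ) (sgn : Bool) (φ : ℝ) :
    Measurable fun θ => ENNReal.ofReal (sin θ * Sang k m a sgn θ φ) := by
  have h : Continuous fun θ : ℝ => (φ, θ) := by fun_prop
  have := (Sang_cont k m a sgn).comp h
  exact this.measurable.ennreal_ofReal

lemma Iint_nonneg (k m : ℕ) : 0 ≤ Iint k m := by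
  apply intervalIntegral.integral_nonneg (by norm_num)
  intro t ht
  have : 0 ≤ 1 - t ^ 2 := by nlinarith [ht.1, ht.2]
  positivity

lemma ang_int {n : ℤ} {k : ℕ} (h : degRel (n + 1) k) (m : ℕ) (sgn : Bool)
    (h0 : m = 0 → sgn = true) :
    ∫⁻ φ in Set.Ioo (-π) π, ∫⁻ θ in Set.Ioo 0 π,
      ENNReal.ofReal (sin θ * Sang k m ((n : ℝ) + 1 - m) sgn θ φ)
    = ENNReal.ofReal (π * ((if m = 0 then (1 : ℝ) else 0) + 1) *
      (((n : ℝ) + 1) * (2 * (n + 1) + 1) * Iint k m)) := by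
  have c := Qc_cont k m
  have c' := Qc_cont k (m + 1)
  have e := PhiFac_cont m sgn
  have hnn : ∀ φ, ∀ θ ∈ Set.Ioo 0 π, 0 ≤ sin θ * Sang k m ((n : ℝ) + 1 - m) sgn θ φ :=
    fun φ θ hθ => mul_nonneg (sin_pos_of_mem_Ioo hθ).le (Sang_nonneg h m sgn θ φ)
  have h1 : ∀ φ, ∫⁻ θ in Set.Ioo 0 π,
      ENNReal.ofReal (sin θ * Sang k m ((n : ℝ) + 1 - m) sgn θ φ) =
      ENNReal.ofReal (alph k m ((n : ℝ) + 1 - m) * PhiFac m sgn φ ^ 2 + bet k m) := by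
    intro φ
    rw [lint_ofReal _ _ _ pi_pos.le _ (hnn φ), Sang_int]
    simp only [Sang]
    fun_prop
  have hnn2 : ∀ φ, 0 ≤ alph k m ((n : ℝ) + 1 - m) * PhiFac m sgn φ ^ 2 + bet k m := by
    intro φ
    rw [← Sang_int, intervalIntegral.integral_of_le pi_pos.le, integral_Ioc_eq_integral_Ioo]
    exact setIntegral_nonneg measurableSet_Ioo (hnn φ)
  simp_rw [h1]
  rw [lint_ofReal _ _ _ (by linarith [pi_pos]) (by fun_prop) (fun φ _ => hnn2 φ),
    intervalIntegral.integral_add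
    (by apply Continuous.intervalIntegrable; fun_prop)
    (by apply Continuous.intervalIntegrable; fun_prop), intervalIntegral.integral_const_mul,
    Phi_int m sgn h0, intervalIntegral.integral_const]
  have hN := degRel_id h
  rw [← alph_bet k m _ hN]
  congr 1
  by_cases hm : m = 0
  · have : bet k m = 0 := by rw [bet, hm]; simp
    rw [this, if_pos hm]; simp; ring
  · rw [if_neg hm]; simp; ring

lemma main_int {n : ℤ} {k : ℕ} (h : degRel (n + 1) k) (m : ℕ) (sgn : Bool)
    (h0 : m = 0 → sgn = true) (T : Set E3) (A : Set ℝ) (hA : MeasurableSet A)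
    (hT : ∀ x, x ∈ T ↔ ‖x‖ ∈ A) (R : ℝ) (hR0 : 0 ≤ R)
    (hR : ∫⁻ ρ in Set.Ioi (0 : ℝ), A.indicator (fun ρ => ENNReal.ofReal (ρ ^ (2 * n + 2))) ρ
      = ENNReal.ofReal R) :
    ∫ x in T, qip (Xmon n m sgn x) (Xmon n m sgn x) =
      R * (π * ((if m = 0 then (1 : ℝ) else 0) + 1) *
      (((n : ℝ) + 1) * (2 * (n + 1) + 1) * Iint k m)) := by
  have hTm : MeasurableSet T := by
    have : T = (fun x : E3 => ‖x‖) ⁻¹' A := by ext x; exact hT x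
    rw [this]; exact measurable_norm hA
  have hq := qip_measurable n m sgn
  rw [integral_eq_lintegral_of_nonneg_ae (Filter.Eventually.of_forall fun x => qip_nonneg _)
    hq.aestronglyMeasurable, ← lintegral_indicator hTm, sph_lint _ (hq.ennreal_ofReal.indicator hTm)]
  have hin : ∀ φ, ∫⁻ ρ in Set.Ioi (0 : ℝ), ∫⁻ θ in Set.Ioo 0 π,
      ENNReal.ofReal (ρ ^ 2 * sin θ) *
        T.indicator (fun x => ENNReal.ofReal (qip (Xmon n m sgn x) (Xmon n m sgn x)))
          (!₂[ρ * cos θ, ρ * sin θ * cos φ, ρ * sin θ * sin φ])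
      = ENNReal.ofReal R * ∫⁻ θ in Set.Ioo 0 π,
        ENNReal.ofReal (sin θ * Sang k m ((n : ℝ) + 1 - m) sgn θ φ) := by
    intro φ
    rw [← hR, ← lintegral_mul_const _ ((zpow_meas (2 * n + 2)).indicator hA)]
    refine setLIntegral_congr_fun measurableSet_Ioi fun ρ hρ => ?_
    have hρ : 0 < ρ := hρ
    rw [← lintegral_const_mul _ (Sang_meas k m _ sgn φ)]
    refine setLIntegral_congr_fun measurableSet_Ioo fun θ hθ => ?_
    have hs := sin_pos_of_mem_Ioo hθ
    change ENNReal.ofReal (ρ ^ 2 * sin θ) * T.indicator _ (sphPt ρ θ φ) = _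
    have hmem : sphPt ρ θ φ ∈ T ↔ ρ ∈ A := by
      rw [hT, ← sphRho_eq, sphRho_sphPt hρ]
    by_cases hA' : ρ ∈ A
    · rw [Set.indicator_of_mem hA', Set.indicator_of_mem (hmem.2 hA'), Xmon_sph h m sgn hρ,
        ← ENNReal.ofReal_mul (by positivity), ← ENNReal.ofReal_mul (by positivity)]
      congr 1
      rw [zpow_add₀ hρ.ne']
      norm_cast
      ring
    · rw [Set.indicator_of_notMem hA', Set.indicator_of_notMem (fun h => hA' (hmem.1 h))]
      simp
  simp_rw [hin]
  rw [lintegral_const_mul, ang_int h m sgn h0, ← ENNReal.ofReal_mul hR0, ENNReal.toReal_ofReal]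
  · apply mul_nonneg hR0
    rw [← degRel_id h]
    have := Iint_nonneg k m
    have := pi_pos
    split_ifs <;> positivity
  · exact Measurable.lintegral_prod_right' (f := fun p : ℝ × ℝ =>
      ENNReal.ofReal (sin p.2 * Sang k m ((n : ℝ) + 1 - m) sgn p.2 p.1))
      (Sang_cont k m _ sgn).measurable.ennreal_ofReal


lemma rad_ball (j : ℕ) :
    ∫⁻ ρ in Set.Ioi (0:ℝ), (Set.Iio (1:ℝ)).indicator
      (fun ρ => ENNReal.ofReal (ρ ^ (2 * (j:ℤ) + 2))) ρ = ENNReal.ofReal (1 / (2 * (j:ℝ) + 3)) := by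
  have h1 : ∀ ρ : ℝ, ρ ^ (2 * (j:ℤ) + 2) = ρ ^ (2 * j + 2) := by
    intro ρ
    have : (2 * (j:ℤ) + 2) = ((2 * j + 2 : ℕ) : ℤ) := by push_cast; ring
    rw [this, zpow_natCast]
  simp only [h1]
  rw [lintegral_indicator measurableSet_Iio, Measure.restrict_restrict measurableSet_Iio,
    Set.inter_comm, Set.Ioi_inter_Iio,
    lint_ofReal (fun ρ => ρ ^ (2 * j + 2)) 0 1 zero_le_one (by fun_prop), integral_pow]
  · congr 1
    push_cast
    simp
    ring
  · intro x hx
    have := hx.1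
    positivity

lemma rad_ext (k : ℕ) :
    ∫⁻ ρ in Set.Ioi (0:ℝ), (Set.Ioi (1:ℝ)).indicator
      (fun ρ => ENNReal.ofReal (ρ ^ (2 * (-2 - (k:ℤ)) + 2))) ρ
      = ENNReal.ofReal (1 / (2 * (k:ℝ) + 1)) := by
  have hlt : (-(2 * (k:ℝ) + 2)) < -1 := by
    have : (0:ℝ) ≤ k := Nat.cast_nonneg k
    linarith
  rw [lintegral_indicator measurableSet_Ioi, Measure.restrict_restrict measurableSet_Ioi,
    Set.Ioi_inter_Ioi]
  have e : ((1:ℝ) ⊔ 0) = 1 := by simp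
  rw [e]
  have h1 : ∫⁻ ρ in Set.Ioi (1:ℝ), ENNReal.ofReal (ρ ^ (2 * (-2 - (k:ℤ)) + 2))
      = ∫⁻ ρ in Set.Ioi (1:ℝ), ENNReal.ofReal (ρ ^ (-(2 * (k:ℝ) + 2))) := by
    refine setLIntegral_congr_fun measurableSet_Ioi fun ρ hρ => ?_
    beta_reduce
    rw [← Real.rpow_intCast]
    push_cast
    congr 2
    ring
  rw [h1, ← ofReal_integral_eq_lintegral_ofReal (integrableOn_Ioi_rpow_of_lt hlt one_pos),
    integral_Ioi_rpow_of_lt hlt one_pos]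
  · congr 1
    rw [Real.one_rpow, show -(2 * (k:ℝ) + 2) + 1 = -(2 * (k:ℝ) + 1) by ring, neg_div_neg_eq]
  · refine (ae_restrict_iff' measurableSet_Ioi).2 (Filter.Eventually.of_forall fun ρ hρ => ?_)
    have : (0:ℝ) < ρ := lt_trans one_pos hρ
    simp only [Pi.zero_apply]
    positivity

/-- squared `L²` norms of `X_{n,m}^{±}`: over the unit ball
(`n ≥ 0`, `0 ≤ m ≤ n+1`) it equals `2π(n+1)(δ_{0,m}+1)(n+m+1)!/((2n+3)(n-m+1)!)`,
and over the exterior of the ball (`n ≤ -2`, `0 ≤ m ≤ -n-2`) it equals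
`2π(n+1)(δ_{0,m}+1)(-n-2+m)!/((2n+3)(-n-2-m)!)`. -/
theorem stmt8 (n : ℤ) (m : ℕ) (sgn : Bool) (h0 : m = 0 → sgn = true) :
    ((0 ≤ n ∧ (m : ℤ) ≤ n + 1) →
      ∫ x in Metric.ball (0 : E3) 1, qip (Xmon n m sgn x) (Xmon n m sgn x) =
        2 * π * ((n : ℝ) + 1) * ((if m = 0 then (1 : ℝ) else 0) + 1) *
          ((n + (m : ℤ) + 1).toNat.factorial : ℝ) /
          ((2 * (n : ℝ) + 3) * ((n - (m : ℤ) + 1).toNat.factorial : ℝ))) ∧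
    ((n ≤ -2 ∧ (m : ℤ) ≤ -n - 2) →
      ∫ x in extB, qip (Xmon n m sgn x) (Xmon n m sgn x) =
        2 * π * ((n : ℝ) + 1) * ((if m = 0 then (1 : ℝ) else 0) + 1) *
          ((-n - 2 + (m : ℤ)).toNat.factorial : ℝ) /
          ((2 * (n : ℝ) + 3) * ((-n - 2 - (m : ℤ)).toNat.factorial : ℝ))) := by
  refine ⟨?_, ?_⟩
  · rintro ⟨hn, hm⟩
    obtain ⟨j, rfl⟩ := Int.eq_ofNat_of_zero_le hn
    have hmk : m ≤ j + 1 := by omega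
    have hdeg : degRel ((j:ℤ) + 1) (j + 1) := Or.inl ⟨by omega, by push_cast; ring⟩
    have hj : (0:ℝ) ≤ j := Nat.cast_nonneg j
    rw [main_int hdeg m sgn h0 (Metric.ball (0 : E3) 1) (Set.Iio 1) measurableSet_Iio
      (by intro x; simp) (1 / (2 * (j:ℝ) + 3)) (by positivity) (rad_ball j), Iint_eq _ _ hmk]
    have e1 : ((j:ℤ) + (m:ℤ) + 1).toNat = j + 1 + m := by omega
    have e2 : ((j:ℤ) - (m:ℤ) + 1).toNat = j + 1 - m := by omega
    rw [e1, e2]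
    have f2 : ((j + 1 - m).factorial : ℝ) ≠ 0 := Nat.cast_ne_zero.2 (Nat.factorial_ne_zero _)
    have f3 : 2 * (j:ℝ) + 3 ≠ 0 := by positivity
    have f4 : 2 * ((j:ℝ) + 1) + 1 = 2 * (j:ℝ) + 3 := by ring
    push_cast
    rw [f4]
    field_simp
  · rintro ⟨hn, hm⟩
    obtain ⟨k, hk⟩ := Int.eq_ofNat_of_zero_le (show 0 ≤ -n - 2 by omega)
    obtain rfl : n = -2 - (k:ℤ) := by omega
    have hmk : m ≤ k := by omega
    have hdeg : degRel (-2 - (k:ℤ) + 1) k := Or.inr ⟨by omega, by ring⟩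
    have hj : (0:ℝ) ≤ k := Nat.cast_nonneg k
    rw [main_int hdeg m sgn h0 extB (Set.Ioi 1) measurableSet_Ioi
      (by intro x; rfl) (1 / (2 * (k:ℝ) + 1)) (by positivity) (rad_ext k), Iint_eq _ _ hmk]
    have e1 : (-(-2 - (k:ℤ)) - 2 + (m:ℤ)).toNat = k + m := by omega
    have e2 : (-(-2 - (k:ℤ)) - 2 - (m:ℤ)).toNat = k - m := by omega
    rw [e1, e2]
    have f2 : ((k - m).factorial : ℝ) ≠ 0 := Nat.cast_ne_zero.2 (Nat.factorial_ne_zero _)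
    have f3 : 2 * (k:ℝ) + 1 ≠ 0 := by positivity
    push_cast
    rw [show 2 * (-2 - (k:ℝ) + 1) + 1 = -(2 * (k:ℝ) + 1) by ring,
      show 2 * (-2 - (k:ℝ)) + 3 = -(2 * (k:ℝ) + 1) by ring]
    field_simp

end
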